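/- arXiv:1612.08269 — 2 statements merged into one kernel-verified Lean document; each statement's English description precedes it below -/
import Mathlib

section
/- Let K ≥ 2 be an integer and let Q(K) be the set of positive integers q such that p^(v_p(q)) ≤ K for every prime p. Then there exists an integer n ≥ 4 such that for every r ∈ Q(K): r divides n−3 if and only if r = 1; r divides n−2 if and only if r divides 2; r divides n−1 if and only if r divides 3; r divides n if and only if r divides 4; r divides n+1 if and only if r divides 5; 6 divides n+2; and r divides n+3 if and only if r = 1. -/
/-- `QSet K` is the set of positive integers `q` such that `p ^ (v_p q) ≤ K`
for every prime `p`. -/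
def QSet (K : ℕ) : Set ℕ :=
  {q | 0 < q ∧ ∀ p : ℕ, Nat.Prime p → p ^ (Nat.factorization q p) ≤ K}

theorem QSet.prime_le {K r p : ℕ} (hr : r ∈ QSet K) (hp : p.Prime) (hpr : p ∣ r) : p ≤ K :=
  (Nat.le_self_pow (hp.factorization_pos_of_dvd hr.1.ne' hpr).ne' p).trans (hr.2 p hp)

/-- There is a multiple of `m` that is `1` modulo a prime `q ∤ m` and divisible by every other
prime up to `K`. -/
theorem exists_multiple_mod_prime_eq_one (K : ℕ) {m q : ℕ} (hq : q.Prime) (hm : ¬ q ∣ m) :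
    ∃ N : ℕ, m ∣ N ∧ N % q = 1 ∧ ∀ p : ℕ, p.Prime → p ≤ K → p ≠ q → p ∣ N := by
  set P := ∏ p ∈ (Finset.range (K + 1)).filter (fun p => p.Prime ∧ p ≠ q), p with hP
  have hcop : Nat.Coprime q (m * P) := by
    refine Nat.Coprime.mul_right ((Nat.Prime.coprime_iff_not_dvd hq).2 hm) ?_
    refine Nat.Coprime.prod_right fun p hp => ?_
    obtain ⟨-, hp, hpq⟩ := Finset.mem_filter.1 hp
    exact (Nat.coprime_primes hq hp).2 hpq.symm
  obtain ⟨t, -, ht⟩ := Nat.exists_mul_mod_eq_one_of_coprime hcop.symm hq.one_lt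
  refine ⟨m * P * t, (dvd_mul_right m P).mul_right t, ht, fun p hp hpK hpq => ?_⟩
  have hpP : p ∣ P := Finset.dvd_prod_of_mem (fun p => p)
    (Finset.mem_filter.2 ⟨Finset.mem_range.2 (Nat.lt_succ_of_le hpK), hp, hpq⟩)
  exact (hpP.mul_left m).mul_right t

/-- If `a ^ 2 ∣ N` and every common prime factor of `r` and `N + a` divides `N`, then `N + a` and
`a` have the same divisibility by `r`. -/
theorem dvd_add_iff_dvd_of_sq_dvd {N a r : ℕ} (haN : a ^ 2 ∣ N)
    (h : ∀ p : ℕ, p.Prime → p ∣ r → p ∣ N + a → p ∣ N) : r ∣ N + a ↔ r ∣ a := by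
  obtain ⟨k, rfl⟩ := haN
  have hfac : a ^ 2 * k + a = a * (a * k + 1) := by ring
  refine ⟨fun hr => ?_, fun hr => hfac ▸ hr.mul_right _⟩
  refine Nat.Coprime.dvd_of_dvd_mul_right (Nat.coprime_of_dvd fun p hp hpr hpk => ?_) (hfac ▸ hr)
  have hpN := h p hp hpr (hfac ▸ hpk.mul_left a)
  have hpak : p ∣ a * k := by
    rw [pow_two, mul_assoc] at hpN
    exact (hp.dvd_mul.1 hpN).elim (fun hpa => hpa.mul_right k) id
  exact hp.one_lt.ne' (Nat.dvd_one.1 ((Nat.dvd_add_right hpak).1 hpk))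

theorem stmt_3 (K : ℕ) (hK : 2 ≤ K) :
    ∃ n : ℕ, 4 ≤ n ∧ 6 ∣ n + 2 ∧ ∀ r ∈ QSet K,
      (r ∣ n - 3 ↔ r = 1) ∧ (r ∣ n - 2 ↔ r ∣ 2) ∧ (r ∣ n - 1 ↔ r ∣ 3) ∧
        (r ∣ n ↔ r ∣ 4) ∧ (r ∣ n + 1 ↔ r ∣ 5) ∧ (r ∣ n + 3 ↔ r = 1) := by
  obtain ⟨N, hN, hN7, hNp⟩ :=
    exists_multiple_mod_prime_eq_one K (m := 3600) (q := 7) (by norm_num) (by norm_num)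
  refine ⟨N + 4, by omega, by omega, fun r hr => ?_⟩
  have hprime : ∀ a, ¬ 7 ∣ N + a → ∀ p : ℕ, p.Prime → p ∣ r → p ∣ N + a → p ∣ N := by
    intro a ha p hp hpr hpa
    exact hNp p hp (QSet.prime_le hr hp hpr) (by rintro rfl; exact ha hpa)
  have key : ∀ a, a ^ 2 ∣ 3600 → ¬ 7 ∣ N + a → (r ∣ N + a ↔ r ∣ a) :=
    fun a ha2 ha7 => dvd_add_iff_dvd_of_sq_dvd (ha2.trans hN) (hprime a ha7)
  refine ⟨?_, key 2 (by norm_num) (by omega),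
    key 3 (by norm_num) (by omega), key 4 (by norm_num) (by omega),
    key 5 (by norm_num) (by omega), ?_⟩
  · exact (key 1 (by norm_num) (by omega)).trans Nat.dvd_one
  · refine ⟨fun h => ?_, fun h => h ▸ one_dvd _⟩
    by_contra hr1
    obtain ⟨p, hp, hpr⟩ := Nat.exists_prime_and_dvd hr1
    have hpa : p ∣ N + 7 := hpr.trans h
    have hpN : p ∣ N := hprime 7 (by omega) p hp hpr hpa
    have hp7 : p = 7 :=
      (Nat.prime_dvd_prime_iff_eq hp (by norm_num)).1 ((Nat.dvd_add_right hpN).1 hpa)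
    subst hp7
    omega
end

section
/- Let K ≥ 2 be an integer and let Q(K) be the set of positive integers q such that p^(v_p(q)) ≤ K for every prime p. Let q ∈ Q(K) be such that 4 divides q and 3 does not divide q. Then there exists an integer n ≥ 4 such that for every r ∈ Q(K): r divides n−3 if and only if r = 1; if 5 divides q then (r divides n−2 if and only if r divides 2) and if 5 does not divide q then (r divides n−2 if and only if r divides 10); r divides n−1 if and only if r divides 3; r divides n if and only if r divides q; and r divides n+1 if and only if r = 1. -/
theorem QSet.le_of_prime_dvd {K r p : ℕ} (hr : r ∈ QSet K) (hp : p.Prime) (h : p ∣ r) :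
    p ≤ K :=
  (Nat.le_self_pow (hp.factorization_pos_of_dvd hr.1.ne' h).ne' p).trans (hr.2 p hp)

/-- To show that an element of `QSet K` divides `d` it suffices to look at prime powers
whose base is at most `K`. -/
theorem QSet.dvd_of_prime_pow {K r m d : ℕ} (hr : r ∈ QSet K) (hrm : r ∣ m)
    (h : ∀ p k : ℕ, p.Prime → p ≤ K → p ∣ m → p ^ k ∣ m → p ^ k ∣ d) : r ∣ d := by
  rw [Nat.dvd_iff_prime_pow_dvd_dvd]
  intro p k hp hk
  rcases Nat.eq_zero_or_pos k with rfl | hk0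
  · simp
  have hpr : p ∣ r := (dvd_pow_self p hk0.ne').trans hk
  exact h p k hp (QSet.le_of_prime_dvd hr hp hpr) (hpr.trans hrm) (hk.trans hrm)

theorem QSet.dvd_of_sq_not_dvd {K r m d : ℕ} (hr : r ∈ QSet K) (hrm : r ∣ m)
    (h : ∀ p : ℕ, p.Prime → p ≤ K → p ∣ m → p ∣ d ∧ ¬ p ^ 2 ∣ m) : r ∣ d := by
  refine QSet.dvd_of_prime_pow hr hrm fun p k hp hpK hpm hk => ?_
  obtain ⟨hd, hsq⟩ := h p hp hpK hpm
  have hk2 : k < 2 := by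
    by_contra! hlt
    exact hsq ((pow_dvd_pow p hlt).trans hk)
  interval_cases k
  · simp
  · simpa using hd

/-- If every prime up to `K` dividing `n = q (1 + q t)` divides `q`, then `n` and `q` have the
same divisors in `QSet K`. -/
theorem QSet.dvd_iff_of_eq_mul {K r n q t : ℕ} (hr : r ∈ QSet K) (hn : n = q * (1 + q * t))
    (h : ∀ p : ℕ, p.Prime → p ≤ K → p ∣ n → p ∣ q) : r ∣ n ↔ r ∣ q := by
  refine ⟨fun hrn => QSet.dvd_of_prime_pow hr hrn fun p k hp hpK hpn hk => ?_,
    fun hrq => hn ▸ hrq.mul_right _⟩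
  have hpq := h p hp hpK hpn
  have hcop : p.Coprime (1 + q * t) := by
    rw [hp.coprime_iff_not_dvd]
    intro hd
    exact hp.one_lt.ne' (Nat.dvd_one.mp ((Nat.dvd_add_left (hpq.mul_right t)).mp hd))
  rw [hn] at hk
  exact (hcop.pow_left k).dvd_of_dvd_mul_right hk

theorem Nat.Prime.eq_two_or_three_or_five_or_seven_le {p : ℕ} (hp : p.Prime) :
    p = 2 ∨ p = 3 ∨ p = 5 ∨ 7 ≤ p := by
  by_contra! h
  have := hp.two_le
  obtain rfl | rfl : p = 4 ∨ p = 6 := by omega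
  · revert hp; norm_num
  · revert hp; norm_num

theorem not_dvd_add_of_seven_le {p n : ℕ} (hp : 7 ≤ p)
    (hn : (p : ℤ) ∣ n ∨ (p : ℤ) ∣ n - 4) {a : ℤ} (ha0 : a ≠ 0)
    (ha : -3 ≤ a) (ha' : a ≤ 1) : ¬ (p : ℤ) ∣ n + a := by
  intro h
  rcases hn with hn | hn
  · have h1 : (p : ℤ) ∣ a := (dvd_add_right hn).mp h
    exact ha0 (Int.eq_zero_of_abs_lt_dvd h1 (by rw [abs_lt]; omega))
  · have h1 : (p : ℤ) ∣ a + 4 := by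
      have := dvd_sub h hn
      ring_nf at this ⊢
      exact this
    have := Int.eq_zero_of_abs_lt_dvd h1 (by rw [abs_lt]; omega)
    omega

/-- Simultaneous congruences modulo `q ^ 2`, `9`, `25` and the remaining primes up to `K`. -/
theorem exists_congruences (K : ℕ) {q : ℕ} (hq4 : 4 ∣ q) (hq0 : 0 < q) (hq3 : ¬ 3 ∣ q) :
    ∃ n t : ℕ, 4 ≤ n ∧ n = q * (1 + q * t) ∧ n % 9 = 4 ∧ (¬ 5 ∣ q → n % 25 = 7) ∧
      ∀ p : ℕ, p.Prime → 7 ≤ p → p ≤ K → ¬ p ∣ q → n ≡ 4 [MOD p] := by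
  set S := (Finset.range (K + 1)).filter fun p => p.Prime ∧ 7 ≤ p ∧ ¬ p ∣ q
  set M := ∏ p ∈ S, p
  have hcopM (a : ℕ) (ha : ∀ p ∈ S, ¬ p ∣ a) : a.Coprime M :=
    Nat.Coprime.prod_right fun p hp =>
      ((Finset.mem_filter.mp hp).2.1.coprime_iff_not_dvd.mpr (ha p hp)).symm
  have hqM : q.Coprime M := hcopM q fun p hp => (Finset.mem_filter.mp hp).2.2.2
  have h5M : Nat.Coprime 5 M := hcopM 5 fun p hp h => by
    have := Nat.le_of_dvd (by norm_num) h
    have := (Finset.mem_filter.mp hp).2.2.1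
    omega
  have hq3' : q.Coprime 3 := ((Nat.prime_three.coprime_iff_not_dvd).mpr hq3).symm
  have hq9M : q.Coprime (9 * M) :=
    Nat.Coprime.mul_right (Nat.Coprime.pow_right 2 hq3') hqM
  have h25 : Nat.Coprime 25 (9 * M) :=
    Nat.Coprime.mul_right (by norm_num) (Nat.Coprime.pow_left 2 h5M)
  obtain ⟨N, c, hN, hc, hc5⟩ : ∃ N c : ℕ, q.Coprime N ∧ (9 * M ∣ N ∧ c ≡ 4 [MOD 9 * M]) ∧
      (¬ 5 ∣ q → 25 ∣ N ∧ c ≡ 7 [MOD 25]) := by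
    by_cases h5 : 5 ∣ q
    · exact ⟨9 * M, 4, hq9M, ⟨dvd_rfl, rfl⟩, fun h => absurd h5 h⟩
    · obtain ⟨c, hc7, hc4⟩ := Nat.chineseRemainder h25 7 4
      have hq5 : q.Coprime 5 := ((Nat.prime_five.coprime_iff_not_dvd).mpr h5).symm
      exact ⟨25 * (9 * M), c, Nat.Coprime.mul_right (Nat.Coprime.pow_right 2 hq5) hq9M,
        ⟨dvd_mul_left _ _, hc4⟩, fun _ => ⟨dvd_mul_right _ _, hc7⟩⟩
  obtain ⟨m, hmq, hmN⟩ := Nat.chineseRemainder (Nat.Coprime.pow_left 2 hN) q c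
  have hq4' := Nat.le_of_dvd hq0 hq4
  have hN0 : 0 < N := by
    rcases Nat.eq_zero_or_pos N with rfl | h
    · rw [Nat.coprime_zero_right] at hN
      omega
    · exact h
  have hle : q ≤ m + q ^ 2 * N := by nlinarith [Nat.mul_le_mul hq4' hN0]
  have hmq' : q ≡ m + q ^ 2 * N [MOD q ^ 2] := by
    simpa [Nat.ModEq] using hmq.symm
  have hmN' : m + q ^ 2 * N ≡ c [MOD N] := by
    simpa [Nat.ModEq] using hmN
  obtain ⟨t, ht⟩ := (Nat.modEq_iff_dvd' hle).mp hmq'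
  have hn4 := (hmN'.of_dvd hc.1).trans hc.2
  refine ⟨m + q ^ 2 * N, t, hq4'.trans hle, ?_, hn4.of_dvd (dvd_mul_right 9 M), ?_, ?_⟩
  · rw [← Nat.sub_add_cancel hle, ht]
    ring
  · intro h5
    exact (hmN'.of_dvd (hc5 h5).1).trans (hc5 h5).2
  · intro p hp hp7 hpK hpq
    have hpS : p ∈ S := Finset.mem_filter.mpr ⟨Finset.mem_range.mpr (by omega), hp, hp7, hpq⟩
    exact hn4.of_dvd ((Finset.dvd_prod_of_mem _ hpS).mul_left 9)

theorem stmt_6 (K : ℕ) (hK : 2 ≤ K) (q : ℕ) (hq : q ∈ QSet K)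
    (hq4 : 4 ∣ q) (hq3 : ¬ 3 ∣ q) :
    ∃ n : ℕ, 4 ≤ n ∧ ∀ r ∈ QSet K,
      (r ∣ n - 3 ↔ r = 1) ∧
        (5 ∣ q → (r ∣ n - 2 ↔ r ∣ 2)) ∧ (¬ 5 ∣ q → (r ∣ n - 2 ↔ r ∣ 10)) ∧
        (r ∣ n - 1 ↔ r ∣ 3) ∧ (r ∣ n ↔ r ∣ q) ∧ (r ∣ n + 1 ↔ r = 1) := by
  obtain ⟨n, t, hn, hnq, hn9, hn5, hnp⟩ := exists_congruences K hq4 hq.1 hq3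
  have hqn : q ∣ n := ⟨_, hnq⟩
  have hn4 : 4 ∣ n := hq4.trans hqn
  have h5q : 5 ∣ q → 5 ∣ n := fun h => h.trans hqn
  have hn5' : 5 ∣ n ∨ n % 25 = 7 := (em (5 ∣ q)).imp h5q hn5
  have hlarge : ∀ p : ℕ, p.Prime → 7 ≤ p → p ≤ K → (p : ℤ) ∣ n ∨ (p : ℤ) ∣ n - 4 := by
    intro p hp hp7 hpK
    by_cases hpq : p ∣ q
    · exact .inl (Int.natCast_dvd_natCast.mpr (hpq.trans hqn))
    · exact .inr (by simpa using (Nat.modEq_iff_dvd.mp (hnp p hp hp7 hpK hpq).symm))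
  have hsub (p : ℕ) (hp : p.Prime) (hp7 : 7 ≤ p) (hpK : p ≤ K) :
      ¬ p ∣ n - 3 ∧ ¬ p ∣ n - 2 ∧ ¬ p ∣ n - 1 ∧ ¬ p ∣ n + 1 := by
    have key {a : ℤ} := not_dvd_add_of_seven_le hp7 (hlarge p hp hp7 hpK) (a := a)
    refine ⟨fun h => key (a := -3) ?_ ?_ ?_ ?_, fun h => key (a := -2) ?_ ?_ ?_ ?_,
      fun h => key (a := -1) ?_ ?_ ?_ ?_, fun h => key (a := 1) ?_ ?_ ?_ ?_⟩ <;>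
    first
    | norm_num; done
    | (rw [← Int.natCast_dvd_natCast] at h
       convert h using 1
       omega)
  refine ⟨n, hn, fun r hr => ⟨⟨fun h => Nat.dvd_one.mp (QSet.dvd_of_sq_not_dvd hr h ?_), ?_⟩,
    fun h5 => ⟨fun h => QSet.dvd_of_sq_not_dvd hr h ?_, fun h => h.trans ?_⟩,
    fun h5 => ⟨fun h => QSet.dvd_of_sq_not_dvd hr h ?_, fun h => h.trans ?_⟩,
    ⟨fun h => QSet.dvd_of_sq_not_dvd hr h ?_, fun h => h.trans ?_⟩,
    QSet.dvd_iff_of_eq_mul hr hnq ?_,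
    ⟨fun h => Nat.dvd_one.mp (QSet.dvd_of_sq_not_dvd hr h ?_), ?_⟩⟩⟩
  case refine_1 =>
    intro p hp hpK hd
    obtain rfl | rfl | rfl | hp7 := hp.eq_two_or_three_or_five_or_seven_le
    · omega
    · omega
    · omega
    · exact absurd hd (hsub p hp hp7 hpK).1
  case refine_2 => rintro rfl; exact one_dvd _
  case refine_3 =>
    intro p hp hpK hd
    have := h5q h5
    obtain rfl | rfl | rfl | hp7 := hp.eq_two_or_three_or_five_or_seven_le
    · omega
    · omega
    · omega
    · exact absurd hd (hsub p hp hp7 hpK).2.1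
  case refine_4 => omega
  case refine_5 =>
    intro p hp hpK hd
    have := hn5 h5
    obtain rfl | rfl | rfl | hp7 := hp.eq_two_or_three_or_five_or_seven_le
    · omega
    · omega
    · omega
    · exact absurd hd (hsub p hp hp7 hpK).2.1
  case refine_6 => have := hn5 h5; omega
  case refine_7 =>
    intro p hp hpK hd
    obtain rfl | rfl | rfl | hp7 := hp.eq_two_or_three_or_five_or_seven_le
    · omega
    · omega
    · omega
    · exact absurd hd (hsub p hp hp7 hpK).2.2.1
  case refine_8 => omega
  case refine_9 =>
    intro p hp hpK hd
    by_contra hpq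
    obtain rfl | rfl | rfl | hp7 := hp.eq_two_or_three_or_five_or_seven_le
    · omega
    · omega
    · have := hn5 hpq; omega
    · have h4 : p ∣ 4 := ((hnp p hp hp7 hpK hpq).dvd_iff dvd_rfl).mp hd
      have := Nat.le_of_dvd (by norm_num) h4
      omega
  case refine_10 =>
    intro p hp hpK hd
    obtain rfl | rfl | rfl | hp7 := hp.eq_two_or_three_or_five_or_seven_le
    · omega
    · omega
    · omega
    · exact absurd hd (hsub p hp hp7 hpK).2.2.2
  case refine_11 => rintro rfl; exact one_dvd _
end
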